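/- Let d be a real number with 0 ≤ d < 1/2. Then the iterated integral ∫₀¹∫₀^{y₁}∫₀^{y₂}∫₀^{y₃}∫₀^{y₄} (y₁−y₂)^(−d)(y₂−y₃)^(−d)(y₁−y₄)^(−d)(y₄−y₅)^(−d)(y₃−y₅)^(−d) dy₅ dy₄ dy₃ dy₂ dy₁ equals (Γ(1−d)²/(1−d))·(Γ(4−5d)·Γ(2−2d)/(Γ(6−5d)·Γ(4−4d)))·₃F₂(d, 1−d, 2−2d; 2−d, 4−4d; 1). -/

import Mathlib

open Real

noncomputable def poch (a : ℝ) (k : ℕ) : ℝ := ∏ i ∈ Finset.range k, (a + i)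

noncomputable def F21 (a b c x : ℝ) : ℝ :=
  ∑' k : ℕ, poch a k * poch b k / (poch c k * (Nat.factorial k : ℝ)) * x ^ k

noncomputable def F32 (a b c e f : ℝ) : ℝ :=
  ∑' k : ℕ, poch a k * poch b k * poch c k / (poch e k * poch f k * (Nat.factorial k : ℝ))

noncomputable def F32x (a b c e f x : ℝ) : ℝ :=
  ∑' k : ℕ, poch a k * poch b k * poch c k / (poch e k * poch f k * (Nat.factorial k : ℝ)) * x ^ k

noncomputable def F43 (a b c g e f h : ℝ) : ℝ :=
  ∑' k : ℕ, poch a k * poch b k * poch c k * poch g k /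
    (poch e k * poch f k * poch h k * (Nat.factorial k : ℝ))

open MeasureTheory ENNReal

noncomputable def pp (a t : ℝ) : ℝ≥0∞ := if 0 < t then ENNReal.ofReal (t ^ (a - 1)) else 0

lemma pp_pos {a t : ℝ} (h : 0 < t) : pp a t = ENNReal.ofReal (t ^ (a - 1)) := by simp [pp, h]

lemma pp_zero {a t : ℝ} (h : t ≤ 0) : pp a t = 0 := by simp [pp, h.not_gt]

lemma pp_ne {a t : ℝ} (h : pp a t ≠ 0) : 0 < t := by
  by_contra h'
  exact h (pp_zero (not_lt.mp h'))

@[fun_prop]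
lemma pp_meas (a : ℝ) : Measurable (pp a) := by
  unfold pp
  refine Measurable.ite (measurableSet_lt measurable_const measurable_id) ?_ measurable_const
  fun_prop

lemma pp_mul (a b t : ℝ) : pp a t * pp b t = pp (a + b - 1) t := by
  by_cases h : 0 < t
  · rw [pp_pos h, pp_pos h, pp_pos h, ← ENNReal.ofReal_mul (by positivity), ← Real.rpow_add h]
    congr 2
    ring
  · simp [pp_zero (not_lt.mp h)]

noncomputable def be (a b : ℝ) : ℝ := Real.Gamma a * Real.Gamma b / Real.Gamma (a + b)

lemma be_pos {a b : ℝ} (ha : 0 < a) (hb : 0 < b) : 0 < be a b := ProbabilityTheory.beta_pos ha hb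

lemma conv_one {a b : ℝ} (ha : 0 < a) (hb : 0 < b) :
    ∫⁻ y, pp a (1 - y) * pp b y = ENNReal.ofReal (be a b) := by
  have h := ProbabilityTheory.lintegral_betaPDF_eq_one hb ha
  have e : ∀ y, pp a (1 - y) * pp b y
      = ENNReal.ofReal (be a b) * ProbabilityTheory.betaPDF b a y := by
    intro y
    rcases le_or_gt y 0 with h1 | h1
    · rw [pp_zero h1, ProbabilityTheory.betaPDF_eq_zero_of_nonpos h1]; simp
    rcases le_or_gt 1 y with h2 | h2
    · rw [pp_zero (by linarith : 1 - y ≤ 0), ProbabilityTheory.betaPDF_eq_zero_of_one_le h2]; simp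
    have hB := be_pos ha hb
    have h3 : 0 < 1 - y := by linarith
    rw [pp_pos h1, pp_pos h3, ProbabilityTheory.betaPDF_of_pos_lt_one h1 h2,
      ← ENNReal.ofReal_mul (by positivity), ← ENNReal.ofReal_mul hB.le]
    congr 1
    have : ProbabilityTheory.beta b a = be a b := by
      unfold ProbabilityTheory.beta be; rw [add_comm, mul_comm]
    rw [this]; field_simp
  simp_rw [e]
  rw [lintegral_const_mul' _ _ ENNReal.ofReal_ne_top, h, mul_one]

lemma conv_x {a b : ℝ} (ha : 0 < a) (hb : 0 < b) (x : ℝ) :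
    ∫⁻ y, pp a (x - y) * pp b y = ENNReal.ofReal (be a b) * pp (a + b) x := by
  rcases le_or_gt x 0 with hx | hx
  · rw [pp_zero hx, mul_zero, lintegral_eq_zero_iff (by fun_prop)]
    refine Filter.Eventually.of_forall fun y => ?_
    rcases le_or_gt y 0 with h1 | h1
    · simp [pp_zero h1]
    · simp [pp_zero (by linarith : x - y ≤ 0)]
  · have hm := Real.smul_map_volume_mul_left hx.ne'
    rw [← hm, lintegral_smul_measure, lintegral_map (by fun_prop) (by fun_prop)]
    have e : ∀ y, pp a (x - x * y) * pp b (x * y)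
        = ENNReal.ofReal (x ^ (a + b - 2)) * (pp a (1 - y) * pp b y) := by
      intro y
      rcases le_or_gt y 0 with h1 | h1
      · rw [pp_zero h1, pp_zero (mul_nonpos_of_nonneg_of_nonpos hx.le h1)]; simp
      rcases le_or_gt 1 y with h2 | h2
      · rw [pp_zero (by linarith : 1 - y ≤ 0), pp_zero (by nlinarith : x - x * y ≤ 0)]; simp
      have h3 : 0 < 1 - y := by linarith
      have h4 : x - x * y = x * (1 - y) := by ring
      rw [h4, pp_pos h1, pp_pos h3, pp_pos (mul_pos hx h1), pp_pos (mul_pos hx h3),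
        ← ENNReal.ofReal_mul (by positivity), ← ENNReal.ofReal_mul (by positivity),
        ← ENNReal.ofReal_mul (by positivity)]
      congr 1
      rw [Real.mul_rpow hx.le h3.le, Real.mul_rpow hx.le h1.le,
        show a + b - 2 = (a - 1) + (b - 1) by ring, Real.rpow_add hx]
      ring
    simp_rw [e]
    rw [lintegral_const_mul' _ _ ENNReal.ofReal_ne_top, conv_one ha hb, abs_of_pos hx, pp_pos hx,
      smul_eq_mul, ← mul_assoc, ← ENNReal.ofReal_mul hx.le, mul_comm]
    congr 2
    nth_rewrite 1 [← Real.rpow_one x]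
    rw [← Real.rpow_add hx]
    congr 1; ring

lemma conv {a b : ℝ} (ha : 0 < a) (hb : 0 < b) (x z : ℝ) :
    ∫⁻ y, pp a (x - y) * pp b (y - z) = ENNReal.ofReal (be a b) * pp (a + b) (x - z) := by
  rw [← conv_x ha hb, ← lintegral_add_right_eq_self _ z]
  congr 1; ext y
  congr 2 <;> ring

lemma nest {x : ℝ} (hx : 0 ≤ x) {B : ℝ → ℝ} {A : ℝ → ℝ≥0∞} (hA : Measurable A)
    (h0 : ∀ y, A y ≠ 0 → 0 < y ∧ y < x)
    (h : ∀ y, 0 < y → y < x → A y ≠ ∞ → B y = (A y).toReal) :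
    (∫⁻ y, A y) ≠ ∞ → ∫ y in (0:ℝ)..x, B y = (∫⁻ y, A y).toReal := by
  intro hfin
  have e : ∫⁻ y, A y = ∫⁻ y in Set.Ioo 0 x, A y := by
    rw [← lintegral_indicator measurableSet_Ioo]
    congr 1; ext y
    by_cases hy : y ∈ Set.Ioo 0 x
    · simp [hy]
    · simp only [hy, not_false_eq_true, Set.indicator_of_notMem]
      by_contra hc
      exact hy (h0 y hc)
  rw [e] at hfin ⊢
  rw [intervalIntegral.integral_of_le hx, integral_Ioc_eq_integral_Ioo]
  have hlt := ae_lt_top hA hfin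
  rw [← integral_toReal hA.aemeasurable hlt]
  apply integral_congr_ae
  filter_upwards [hlt, ae_restrict_mem measurableSet_Ioo] with y hy hm
  exact h y hm.1 hm.2 hy.ne

lemma poch_succ (a : ℝ) (k : ℕ) : poch a (k + 1) = poch a k * (a + k) := by
  simp [poch, Finset.prod_range_succ]

lemma poch_zero (a : ℝ) : poch a 0 = 1 := by simp [poch]

lemma poch_pos {a : ℝ} (ha : 0 < a) (k : ℕ) : 0 < poch a k :=
  Finset.prod_pos fun i _ => by positivity

lemma poch_nonneg {a : ℝ} (ha : 0 ≤ a) (k : ℕ) : 0 ≤ poch a k :=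
  Finset.prod_nonneg fun i _ => by positivity

lemma gamma_poch {a : ℝ} (ha : 0 < a) (k : ℕ) :
    Real.Gamma (a + k) = poch a k * Real.Gamma a := by
  induction k with
  | zero => simp [poch_zero]
  | succ k ih =>
    rw [poch_succ, Nat.cast_succ, ← add_assoc, Real.Gamma_add_one (by positivity), ih]
    ring

lemma mchoose (a : ℝ) (k : ℕ) : Ring.choose (a + k - 1) k = poch a k / k.factorial := by
  have h : Ring.choose (a + k - 1) k = Ring.multichoose a k := by
    rw [Ring.choose]; congr 1; ring
  have h2 := Ring.factorial_nsmul_multichoose_eq_ascPochhammer a k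
  rw [Polynomial.ascPochhammer_smeval_eq_eval, nsmul_eq_mul] at h2
  have h3 : Polynomial.eval a (ascPochhammer ℝ k) = poch a k := by
    clear h h2
    induction k with
    | zero => simp [poch_zero]
    | succ k ih => rw [ascPochhammer_succ_eval, ih, poch_succ]
  rw [h, ← h3, ← h2]
  have := Nat.factorial_ne_zero k
  field_simp

lemma binom (a x : ℝ) (hx0 : 0 ≤ x) (hx1 : x < 1) :
    HasSum (fun k : ℕ => poch a k / k.factorial * x ^ k) ((1 - x) ^ (-a)) := by
  have h := (Real.one_div_one_sub_rpow_hasFPowerSeriesOnBall_zero a).hasSum (y := x)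
    (by rw [Metric.mem_eball, edist_zero_right, Real.enorm_eq_ofReal hx0]; simpa using hx1)
  simp only [zero_add, FormalMultilinearSeries.ofScalars_apply_eq, mchoose, smul_eq_mul] at h
  rw [Real.rpow_neg (by linarith), ← one_div]
  exact h

lemma expand {d : ℝ} (h0 : 0 ≤ d) {u v : ℝ} (hv : 0 < v) (huv : v < u) :
    pp (1 - d) (u - v) = ∑' k : ℕ, ENNReal.ofReal (poch d k / k.factorial) *
      (pp (1 - d - k) u * pp (1 + k) v) := by
  have hu : 0 < u := hv.trans huv
  have hb := binom d (v / u) (by positivity) (by rwa [div_lt_one hu])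
  have hb2 := hb.mul_left (u ^ (-d))
  have hp : ∀ k : ℕ, 0 ≤ poch d k / k.factorial := fun k => div_nonneg (poch_nonneg h0 k) (by positivity)
  have e : u ^ (-d) * (1 - v / u) ^ (-d) = (u - v) ^ (1 - d - 1) := by
    rw [← Real.mul_rpow hu.le]
    · congr 1
      · field_simp
      · ring
    · rw [sub_nonneg, div_le_one hu]; exact huv.le
  rw [pp_pos (by linarith), ← e, ← hb2.tsum_eq, ENNReal.ofReal_tsum_of_nonneg _ hb2.summable]
  · congr 1; ext k
    rw [pp_pos hu, pp_pos hv, ← ENNReal.ofReal_mul (by positivity), ← ENNReal.ofReal_mul (hp k)]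
    congr 1
    rw [show 1 - d - (k:ℝ) - 1 = -d - k by ring, Real.rpow_sub hu,
      show 1 + (k:ℝ) - 1 = k by ring, Real.rpow_natCast, Real.rpow_natCast, div_pow]
    ring
  · intro k
    have := hp k
    positivity

lemma swap4 (g : ℝ → ℝ → ℝ → ℝ → ℝ≥0∞)
    (hg : Measurable fun p : ℝ × ℝ × ℝ × ℝ => g p.1 p.2.1 p.2.2.1 p.2.2.2) :
    ∫⁻ y2, ∫⁻ y3, ∫⁻ y4, ∫⁻ y5, g y2 y3 y4 y5 = ∫⁻ y5, ∫⁻ y3, ∫⁻ y2, ∫⁻ y4, g y2 y3 y4 y5 := by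
  have comp : ∀ {α : Type} [MeasurableSpace α] (a b c e : α → ℝ), Measurable a → Measurable b →
      Measurable c → Measurable e → Measurable fun x => g (a x) (b x) (c x) (e x) := by
    intro α _ a b c e ha hb hc he
    exact hg.comp (ha.prodMk (hb.prodMk (hc.prodMk he)))
  calc ∫⁻ y2, ∫⁻ y3, ∫⁻ y4, ∫⁻ y5, g y2 y3 y4 y5
      = ∫⁻ y2, ∫⁻ y3, ∫⁻ y5, ∫⁻ y4, g y2 y3 y4 y5 := by
        congr 1; ext y2; congr 1; ext y3
        refine lintegral_lintegral_swap (Measurable.aemeasurable ?_)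
        exact comp _ _ _ _ (by fun_prop) (by fun_prop) (by fun_prop) (by fun_prop)
    _ = ∫⁻ y2, ∫⁻ y5, ∫⁻ y3, ∫⁻ y4, g y2 y3 y4 y5 := by
        congr 1; ext y2
        refine lintegral_lintegral_swap (Measurable.aemeasurable ?_)
        refine Measurable.lintegral_prod_right' (f := fun q : (ℝ × ℝ) × ℝ => g y2 q.1.1 q.2 q.1.2) ?_
        exact comp _ _ _ _ (by fun_prop) (by fun_prop) (by fun_prop) (by fun_prop)
    _ = ∫⁻ y5, ∫⁻ y2, ∫⁻ y3, ∫⁻ y4, g y2 y3 y4 y5 := by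
        refine lintegral_lintegral_swap (Measurable.aemeasurable ?_)
        refine Measurable.lintegral_prod_right'
          (f := fun q : (ℝ × ℝ) × ℝ => ∫⁻ y4, g q.1.1 q.2 y4 q.1.2) ?_
        refine Measurable.lintegral_prod_right'
          (f := fun q : ((ℝ × ℝ) × ℝ) × ℝ => g q.1.1.1 q.1.2 q.2 q.1.1.2) ?_
        exact comp _ _ _ _ (by fun_prop) (by fun_prop) (by fun_prop) (by fun_prop)
    _ = ∫⁻ y5, ∫⁻ y3, ∫⁻ y2, ∫⁻ y4, g y2 y3 y4 y5 := by
        congr 1; ext y5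
        refine lintegral_lintegral_swap (Measurable.aemeasurable ?_)
        refine Measurable.lintegral_prod_right' (f := fun q : (ℝ × ℝ) × ℝ => g q.1.1 q.1.2 q.2 y5) ?_
        exact comp _ _ _ _ (by fun_prop) (by fun_prop) (by fun_prop) (by fun_prop)

noncomputable def ff (d y1 y2 y3 y4 y5 : ℝ) : ℝ≥0∞ :=
  (pp 1 (1 - y1) * pp 1 y5) * ((pp (1 - d) (y1 - y2) * pp (1 - d) (y2 - y3)) *
    (pp (1 - d) (y3 - y5) * (pp (1 - d) (y1 - y4) * pp (1 - d) (y4 - y5) * pp 1 (y3 - y4))))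

lemma ff_meas {α : Type} [MeasurableSpace α] (d : ℝ) {y1 y2 y3 y4 y5 : α → ℝ}
    (m1 : Measurable y1) (m2 : Measurable y2) (m3 : Measurable y3) (m4 : Measurable y4)
    (m5 : Measurable y5) :
    Measurable fun x => ff d (y1 x) (y2 x) (y3 x) (y4 x) (y5 x) := by
  unfold ff
  fun_prop

lemma ff_ne {d y1 y2 y3 y4 y5 : ℝ} (h : ff d y1 y2 y3 y4 y5 ≠ 0) :
    0 < y5 ∧ y5 < y4 ∧ y4 < y3 ∧ y3 < y2 ∧ y2 < y1 ∧ y1 < 1 := by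
  unfold ff at h
  simp only [mul_ne_zero_iff] at h
  obtain ⟨⟨a1, a2⟩, ⟨a3, a4⟩, a5, ⟨a6, a7⟩, a8⟩ := h
  have := pp_ne a1
  have := pp_ne a2
  have := pp_ne a3
  have := pp_ne a4
  have := pp_ne a7
  have := pp_ne a8
  refine ⟨?_, ?_, ?_, ?_, ?_, ?_⟩ <;> linarith

lemma ff_val {d y1 y2 y3 y4 y5 : ℝ} (h5 : 0 < y5) (h4 : y5 < y4) (h3 : y4 < y3) (h2 : y3 < y2)
    (h1 : y2 < y1) (h0 : y1 < 1) :
    (y1 - y2) ^ (-d) * (y2 - y3) ^ (-d) * (y1 - y4) ^ (-d) * (y4 - y5) ^ (-d) * (y3 - y5) ^ (-d)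
      = (ff d y1 y2 y3 y4 y5).toReal := by
  have a1 : 0 < 1 - y1 := by linarith
  have a2 : 0 < y1 - y2 := by linarith
  have a3 : 0 < y2 - y3 := by linarith
  have a4 : 0 < y1 - y4 := by linarith
  have a5 : 0 < y4 - y5 := by linarith
  have a6 : 0 < y3 - y5 := by linarith
  have a7 : 0 < y3 - y4 := by linarith
  unfold ff
  rw [pp_pos a1, pp_pos a2, pp_pos a3, pp_pos a4, pp_pos a5, pp_pos a6, pp_pos a7, pp_pos h5]
  simp only [ENNReal.toReal_mul]
  have e : (1:ℝ) - d - 1 = -d := by ring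
  rw [ENNReal.toReal_ofReal (by positivity), ENNReal.toReal_ofReal (by positivity),
    ENNReal.toReal_ofReal (by positivity), ENNReal.toReal_ofReal (by positivity),
    ENNReal.toReal_ofReal (by positivity), ENNReal.toReal_ofReal (by positivity),
    ENNReal.toReal_ofReal (by positivity), ENNReal.toReal_ofReal (by positivity), e]
  simp only [sub_self, Real.rpow_zero]
  ring

noncomputable def cc (d : ℝ) (k : ℕ) : ℝ≥0∞ := ENNReal.ofReal (poch d k / k.factorial)

noncomputable def DD (d : ℝ) (k : ℕ) : ℝ≥0∞ :=
  ENNReal.ofReal (be (1 - d) (1 - d)) * cc d k * ENNReal.ofReal (be 1 (1 - d + k)) *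
    ENNReal.ofReal (be (2 - 2 * d) (2 - 2 * d + k))

lemma int4 {d : ℝ} (h0 : 0 ≤ d) (h1 : d < 1/2) {y1 y3 y5 : ℝ} (h31 : y3 < y1) :
    ∫⁻ y4, pp (1 - d) (y1 - y4) * pp (1 - d) (y4 - y5) * pp 1 (y3 - y4) =
      ∑' k : ℕ, cc d k * pp (1 - d - k) (y1 - y5) *
        (ENNReal.ofReal (be 1 (1 - d + k)) * pp (2 - d + k) (y3 - y5)) := by
  have e : ∀ y4, pp (1 - d) (y1 - y4) * pp (1 - d) (y4 - y5) * pp 1 (y3 - y4) =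
      ∑' k : ℕ, cc d k * pp (1 - d - k) (y1 - y5) * (pp 1 (y3 - y4) * pp (1 - d + k) (y4 - y5)) := by
    intro y4
    rcases le_or_gt y4 y5 with a | a
    · simp [pp_zero (sub_nonpos.mpr a)]
    rcases le_or_gt y3 y4 with b | b
    · simp [pp_zero (sub_nonpos.mpr b)]
    rw [show y1 - y4 = (y1 - y5) - (y4 - y5) by ring, expand h0 (by linarith) (by linarith),
      mul_assoc, ← ENNReal.tsum_mul_right]
    congr 1; ext k
    rw [show 1 - d + (k:ℝ) = (1 + k) + (1 - d) - 1 by ring, ← pp_mul, cc]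
    ring
  simp_rw [e]
  rw [lintegral_tsum (fun k => by fun_prop)]
  congr 1; ext k
  have hk : (0:ℝ) ≤ k := Nat.cast_nonneg k
  rw [lintegral_const_mul _ (by fun_prop), conv one_pos (by linarith)]
  rw [show 1 + (1 - d + (k:ℝ)) = 2 - d + k by ring]

lemma int24 {d : ℝ} (h0 : 0 ≤ d) (h1 : d < 1/2) (y1 y3 y5 : ℝ) :
    ∫⁻ y2, ∫⁻ y4, ff d y1 y2 y3 y4 y5 = (pp 1 (1 - y1) * pp 1 y5) *
      ∑' k : ℕ, ENNReal.ofReal (be (1 - d) (1 - d)) * cc d k * ENNReal.ofReal (be 1 (1 - d + k)) *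
        pp (1 - d - k) (y1 - y5) * (pp (2 - 2 * d) (y1 - y3) * pp (2 - 2 * d + k) (y3 - y5)) := by
  unfold ff
  have e : ∀ y2, ∫⁻ y4, (pp 1 (1 - y1) * pp 1 y5) * ((pp (1 - d) (y1 - y2) * pp (1 - d) (y2 - y3)) *
    (pp (1 - d) (y3 - y5) * (pp (1 - d) (y1 - y4) * pp (1 - d) (y4 - y5) * pp 1 (y3 - y4))))
     = (pp 1 (1 - y1) * pp 1 y5) * ((pp (1 - d) (y1 - y2) * pp (1 - d) (y2 - y3)) *
    (pp (1 - d) (y3 - y5) *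
      ∫⁻ y4, (pp (1 - d) (y1 - y4) * pp (1 - d) (y4 - y5) * pp 1 (y3 - y4)))) := by
    intro y2
    rw [lintegral_const_mul _ (by fun_prop), lintegral_const_mul _ (by fun_prop),
      lintegral_const_mul _ (by fun_prop)]
  simp_rw [e]
  rw [lintegral_const_mul _ (by fun_prop), lintegral_mul_const _ (by fun_prop),
    conv (by linarith) (by linarith), show 1 - d + (1 - d) = 2 - 2 * d by ring]
  congr 1
  rcases le_or_gt y1 y3 with a | a
  · simp [pp_zero (sub_nonpos.mpr a)]
  rw [int4 h0 h1 a, ← ENNReal.tsum_mul_left, ← ENNReal.tsum_mul_left]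
  congr 1; ext k
  rw [show 2 - 2 * d + (k:ℝ) = (1 - d) + (2 - d + k) - 1 by ring, ← pp_mul]
  ring

lemma int324 {d : ℝ} (h0 : 0 ≤ d) (h1 : d < 1/2) (y1 y5 : ℝ) :
    ∫⁻ y3, ∫⁻ y2, ∫⁻ y4, ff d y1 y2 y3 y4 y5 = (∑' k : ℕ, DD d k) *
      (pp 1 (1 - y1) * (pp (4 - 5 * d) (y1 - y5) * pp 1 (y5 - 0))) := by
  simp_rw [int24 h0 h1]
  rw [lintegral_const_mul _ (by fun_prop), lintegral_tsum (fun k => by fun_prop),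
    ← ENNReal.tsum_mul_left, ← ENNReal.tsum_mul_right]
  congr 1; ext k
  have hk : (0:ℝ) ≤ k := Nat.cast_nonneg k
  rw [lintegral_const_mul _ (by fun_prop), conv (by linarith) (by linarith),
    show 4 - 5 * d = (1 - d - k) + (2 - 2 * d + (2 - 2 * d + k)) - 1 by ring, ← pp_mul, DD, sub_zero]
  ring

lemma total {d : ℝ} (h0 : 0 ≤ d) (h1 : d < 1/2) :
    ∫⁻ y1, ∫⁻ y2, ∫⁻ y3, ∫⁻ y4, ∫⁻ y5, ff d y1 y2 y3 y4 y5 = (∑' k : ℕ, DD d k) *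
      (ENNReal.ofReal (be (4 - 5 * d) 1) * ENNReal.ofReal (be 1 (5 - 5 * d))) := by
  have e : ∀ y1, ∫⁻ y2, ∫⁻ y3, ∫⁻ y4, ∫⁻ y5, ff d y1 y2 y3 y4 y5 = (∑' k : ℕ, DD d k) *
      ((ENNReal.ofReal (be (4 - 5 * d) 1)) * (pp 1 (1 - y1) * pp (5 - 5 * d) (y1 - 0))) := by
    intro y1
    rw [swap4 (fun y2 y3 y4 y5 => ff d y1 y2 y3 y4 y5)
      (ff_meas _ (by fun_prop) (by fun_prop) (by fun_prop) (by fun_prop) (by fun_prop))]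
    simp_rw [int324 h0 h1]
    rw [lintegral_const_mul _ (by fun_prop), lintegral_const_mul _ (by fun_prop),
      conv (by linarith) one_pos, show 4 - 5 * d + 1 = 5 - 5 * d by ring]
    ring
  simp_rw [e]
  rw [lintegral_const_mul _ (by fun_prop), lintegral_const_mul _ (by fun_prop),
      conv one_pos (by linarith), pp_pos (by norm_num)]
  simp

lemma tt_bound {d : ℝ} (h0 : 0 ≤ d) (h1 : d < 1/2) (k : ℕ) :
    poch d k * poch (1-d) k * poch (2-2*d) k / (poch (2-d) k * poch (4-4*d) k * (Nat.factorial k : ℝ))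
      ≤ 1 / ((k:ℝ) + 1) ^ 2 := by
  have key : ∀ a b : ℝ, 0 < a → a + 1 ≤ b → (∀ i : ℝ, 0 ≤ i → (a + i) * (2 + i) ≤ (1 + i) * (b + i)) →
      poch a k / poch b k ≤ 1 / ((k:ℝ) + 1) := by
    intro a b ha hb hi
    induction k with
    | zero => simp [poch_zero]
    | succ k ih =>
      have hbk := poch_pos (show 0 < b by linarith) k
      have hak := poch_pos ha k
      have hk : (0:ℝ) ≤ k := Nat.cast_nonneg k
      have hbk' : 0 < b + k := by linarith
      have h2 : (a + k) / (b + k) ≤ (k + 1) / ((k:ℝ) + 1 + 1) := by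
        rw [div_le_div_iff₀ hbk' (by positivity)]
        have := hi k hk
        linarith
      rw [poch_succ, poch_succ, mul_div_mul_comm]
      calc _ ≤ 1 / ((k:ℝ) + 1) * ((k + 1) / ((k:ℝ) + 1 + 1)) := by
            gcongr
        _ = _ := by push_cast; field_simp
  have k1 := key (1-d) (2-d) (by linarith) (by linarith) (fun i hi => by nlinarith)
  have k2 := key (2-2*d) (4-4*d) (by linarith) (by linarith) (fun i hi => by nlinarith)
  have k3 : poch d k / k.factorial ≤ 1 := by
    rw [div_le_one (by positivity), ← Finset.prod_range_add_one_eq_factorial, poch]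
    push_cast
    exact Finset.prod_le_prod (fun i _ => by positivity) (fun i _ => by linarith)
  have p1 := poch_nonneg h0 k
  have p2 := poch_pos (show 0 < 1 - d by linarith) k
  have p3 := poch_pos (show 0 < 2 - d by linarith) k
  have p4 := poch_pos (show 0 < 2 - 2 * d by linarith) k
  have p5 := poch_pos (show 0 < 4 - 4 * d by linarith) k
  calc _ = (poch d k / k.factorial) * ((poch (1-d) k / poch (2-d) k) * (poch (2-2*d) k / poch (4-4*d) k)) := by
        field_simp
    _ ≤ 1 * ((1 / ((k:ℝ) + 1)) * (1 / ((k:ℝ) + 1))) := by gcongr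
    _ = _ := by field_simp

lemma DD_eq {d : ℝ} (h0 : 0 ≤ d) (h1 : d < 1/2) (k : ℕ) :
    DD d k = ENNReal.ofReal ((Gamma (1-d) ^ 2 / (1-d) * (Gamma (2-2*d) / Gamma (4-4*d))) *
      (poch d k * poch (1-d) k * poch (2-2*d) k /
        (poch (2-d) k * poch (4-4*d) k * (Nat.factorial k : ℝ)))) := by
  have hk : (0:ℝ) ≤ k := Nat.cast_nonneg k
  have b1 := be_pos (show 0 < 1 - d by linarith) (show 0 < 1 - d by linarith)
  have b2 := be_pos one_pos (show 0 < 1 - d + k by linarith)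
  have p1 := poch_nonneg h0 k
  have p3 := poch_pos (show 0 < 2 - d by linarith) k
  have p5 := poch_pos (show 0 < 4 - 4 * d by linarith) k
  have g1 := Real.Gamma_pos_of_pos (show 0 < 1 - d by linarith)
  have g2 := Real.Gamma_pos_of_pos (show 0 < 2 - 2 * d by linarith)
  have g4 := Real.Gamma_pos_of_pos (show 0 < 4 - 4 * d by linarith)
  have hd : 0 < 1 - d := by linarith
  rw [DD, cc, ← ENNReal.ofReal_mul (by positivity), ← ENNReal.ofReal_mul (by positivity),
    ← ENNReal.ofReal_mul (by positivity)]
  congr 1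
  unfold be
  rw [Real.Gamma_one, show 1 - d + (1 - d) = 2 - 2 * d by ring,
    show 1 + (1 - d + (k:ℝ)) = (2 - d) + k by ring,
    show 2 - 2 * d + (2 - 2 * d + (k:ℝ)) = (4 - 4 * d) + k by ring,
    gamma_poch (by linarith), gamma_poch (by linarith), gamma_poch (by linarith),
    gamma_poch (by linarith), show 2 - d = (1 - d) + 1 by ring, Real.Gamma_add_one hd.ne']
  rw [show 2 - d = (1 - d) + 1 by ring] at p3
  field_simp

theorem stmt7 (d : ℝ) (h0 : 0 ≤ d) (h1 : d < 1/2) :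
    (∫ y1 in (0:ℝ)..1, ∫ y2 in (0:ℝ)..y1, ∫ y3 in (0:ℝ)..y2, ∫ y4 in (0:ℝ)..y3, ∫ y5 in (0:ℝ)..y4,
      (y1 - y2) ^ (-d) * (y2 - y3) ^ (-d) * (y1 - y4) ^ (-d) * (y4 - y5) ^ (-d) * (y3 - y5) ^ (-d)) =
    Gamma (1-d) ^ 2 / (1-d) * (Gamma (4-5*d) * Gamma (2-2*d) / (Gamma (6-5*d) * Gamma (4-4*d))) *
      F32 d (1-d) (2-2*d) (2-d) (4-4*d) := by
  have hk : ∀ k : ℕ, 0 ≤ poch d k * poch (1-d) k * poch (2-2*d) k /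
        (poch (2-d) k * poch (4-4*d) k * (Nat.factorial k : ℝ)) := by
    intro k
    have p1 := poch_nonneg h0 k
    have p2 := poch_pos (show 0 < 1 - d by linarith) k
    have p3 := poch_pos (show 0 < 2 - d by linarith) k
    have p4 := poch_pos (show 0 < 2 - 2 * d by linarith) k
    have p5 := poch_pos (show 0 < 4 - 4 * d by linarith) k
    positivity
  have hs : Summable fun k : ℕ => poch d k * poch (1-d) k * poch (2-2*d) k /
        (poch (2-d) k * poch (4-4*d) k * (Nat.factorial k : ℝ)) := by
    refine Summable.of_nonneg_of_le hk (tt_bound h0 h1) ?_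
    have := (summable_nat_add_iff 1).mpr (Real.summable_one_div_nat_pow.mpr (show 1 < 2 by norm_num))
    simpa using this
  have hd : 0 < 1 - d := by linarith
  have g1 := Real.Gamma_pos_of_pos hd
  have g2 := Real.Gamma_pos_of_pos (show 0 < 2 - 2 * d by linarith)
  have g4 := Real.Gamma_pos_of_pos (show 0 < 4 - 4 * d by linarith)
  have g5 := Real.Gamma_pos_of_pos (show 0 < 5 - 5 * d by linarith)
  have g6 := Real.Gamma_pos_of_pos (show 0 < 6 - 5 * d by linarith)
  have b1 := be_pos (show 0 < 4 - 5 * d by linarith) one_pos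
  have b2 := be_pos one_pos (show 0 < 5 - 5 * d by linarith)
  have hT := total h0 h1
  simp_rw [DD_eq h0 h1] at hT
  rw [← ENNReal.ofReal_tsum_of_nonneg (fun k => mul_nonneg (by positivity) (hk k)) (hs.mul_left _),
    tsum_mul_left, ← ENNReal.ofReal_mul b1.le, ← ENNReal.ofReal_mul
      (mul_nonneg (by positivity) (tsum_nonneg hk))] at hT
  have hfin : ∫⁻ y1, ∫⁻ y2, ∫⁻ y3, ∫⁻ y4, ∫⁻ y5, ff d y1 y2 y3 y4 y5 ≠ ∞ := by
    rw [hT]; exact ENNReal.ofReal_ne_top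
  have ne1 : ∀ {A : ℝ → ℝ≥0∞}, ∫⁻ y, A y ≠ 0 → ∃ y, A y ≠ 0 := by
    intro A h
    by_contra hc
    push Not at hc
    exact h (by simp [hc])
  have hmain := nest zero_le_one (A := fun y1 => ∫⁻ y2, ∫⁻ y3, ∫⁻ y4, ∫⁻ y5, ff d y1 y2 y3 y4 y5)
    (B := fun y1 => ∫ y2 in (0:ℝ)..y1, ∫ y3 in (0:ℝ)..y2, ∫ y4 in (0:ℝ)..y3, ∫ y5 in (0:ℝ)..y4,
      (y1 - y2) ^ (-d) * (y2 - y3) ^ (-d) * (y1 - y4) ^ (-d) * (y4 - y5) ^ (-d) * (y3 - y5) ^ (-d))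
    ?_ ?_ ?_ hfin
  · rw [hmain, hT, ENNReal.toReal_ofReal (mul_nonneg (mul_nonneg (by positivity) (tsum_nonneg hk))
      (by positivity))]
    unfold F32 be
    rw [Real.Gamma_one, show 4 - 5 * d + 1 = 5 - 5 * d by ring,
      show 1 + (5 - 5 * d) = 6 - 5 * d by ring]
    field_simp
  · refine Measurable.lintegral_prod_right' (f := fun q : ℝ × ℝ => ∫⁻ y3, ∫⁻ y4, ∫⁻ y5, ff d q.1 q.2 y3 y4 y5) ?_
    refine Measurable.lintegral_prod_right' (f := fun q : (ℝ × ℝ) × ℝ => ∫⁻ y4, ∫⁻ y5, ff d q.1.1 q.1.2 q.2 y4 y5) ?_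
    refine Measurable.lintegral_prod_right' (f := fun q : ((ℝ × ℝ) × ℝ) × ℝ => ∫⁻ y5, ff d q.1.1.1 q.1.1.2 q.1.2 q.2 y5) ?_
    refine Measurable.lintegral_prod_right' (f := fun q : (((ℝ × ℝ) × ℝ) × ℝ) × ℝ => ff d q.1.1.1.1 q.1.1.1.2 q.1.1.2 q.1.2 q.2) ?_
    exact ff_meas _ (by fun_prop) (by fun_prop) (by fun_prop) (by fun_prop) (by fun_prop)
  · intro y1 h
    obtain ⟨y2, h⟩ := ne1 h
    obtain ⟨y3, h⟩ := ne1 h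
    obtain ⟨y4, h⟩ := ne1 h
    obtain ⟨y5, h⟩ := ne1 h
    have := ff_ne h
    constructor <;> linarith
  intro y1 hy1 hy1'
  refine nest hy1.le ?_ ?_ ?_
  · refine Measurable.lintegral_prod_right' (f := fun q : ℝ × ℝ => ∫⁻ y4, ∫⁻ y5, ff d y1 q.1 q.2 y4 y5) ?_
    refine Measurable.lintegral_prod_right' (f := fun q : (ℝ × ℝ) × ℝ => ∫⁻ y5, ff d y1 q.1.1 q.1.2 q.2 y5) ?_
    refine Measurable.lintegral_prod_right' (f := fun q : ((ℝ × ℝ) × ℝ) × ℝ => ff d y1 q.1.1.1 q.1.1.2 q.1.2 q.2) ?_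
    exact ff_meas _ (by fun_prop) (by fun_prop) (by fun_prop) (by fun_prop) (by fun_prop)
  · intro y2 h
    obtain ⟨y3, h⟩ := ne1 h
    obtain ⟨y4, h⟩ := ne1 h
    obtain ⟨y5, h⟩ := ne1 h
    have := ff_ne h
    constructor <;> linarith
  intro y2 hy2 hy2'
  refine nest hy2.le ?_ ?_ ?_
  · refine Measurable.lintegral_prod_right' (f := fun q : ℝ × ℝ => ∫⁻ y5, ff d y1 y2 q.1 q.2 y5) ?_
    refine Measurable.lintegral_prod_right' (f := fun q : (ℝ × ℝ) × ℝ => ff d y1 y2 q.1.1 q.1.2 q.2) ?_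
    exact ff_meas _ (by fun_prop) (by fun_prop) (by fun_prop) (by fun_prop) (by fun_prop)
  · intro y3 h
    obtain ⟨y4, h⟩ := ne1 h
    obtain ⟨y5, h⟩ := ne1 h
    have := ff_ne h
    constructor <;> linarith
  intro y3 hy3 hy3'
  refine nest hy3.le ?_ ?_ ?_
  · refine Measurable.lintegral_prod_right' (f := fun q : ℝ × ℝ => ff d y1 y2 y3 q.1 q.2) ?_
    exact ff_meas _ (by fun_prop) (by fun_prop) (by fun_prop) (by fun_prop) (by fun_prop)
  · intro y4 h
    obtain ⟨y5, h⟩ := ne1 h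
    have := ff_ne h
    constructor <;> linarith
  intro y4 hy4 hy4'
  refine nest hy4.le ?_ ?_ ?_
  · exact ff_meas _ (by fun_prop) (by fun_prop) (by fun_prop) (by fun_prop) (by fun_prop)
  · intro y5 h
    have := ff_ne h
    constructor <;> linarith
  intro y5 hy5 hy5' _
  exact ff_val hy5 hy5' hy4' hy3' hy2' hy1'
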